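/- arXiv:2010.16367 — 3 statements merged into one kernel-verified Lean document; each statement's English description precedes it below -/
import Mathlib

section
/- For a matrix [[a, b], [c, d]] ∈ SL₂(ℤ) with c ≠ 0 acting on the upper half-plane by Möbius transformations, the logarithm of the Dedekind eta function satisfies L((aτ+b)/(cτ+d)) = L(τ) + (1/4)·Log(−(cτ+d)²) + (πi/12)·((a+d)/c − 12·S(d, c)), where L is the principal branch of log η and Log is the principal branch of the logarithm. -/
-- The sawtooth function `((x))`: `0` for `x ∈ ℤ`, `x − ⌊x⌋ − 1/2` otherwise.
open Classical in
noncomputable def sawtooth (x : ℝ) : ℝ :=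
  if ∃ z : ℤ, (z : ℝ) = x then 0 else x - ⌊x⌋ - 1 / 2

/-- The Dedekind sum `S(k, n) = Σ_{j=1}^{|n|−1} ((j/|n|))((jk/n))`.  For `n > 0` this is
(0.3); for `n < 0` it equals `−S(k, −n)` (Rademacher's sign convention), which is the
extension for which the transformation law (A.1) holds for all `c ≠ 0`. -/
noncomputable def dedekindSum (k n : ℤ) : ℝ :=
  ∑ j ∈ Finset.Ioo (0 : ℤ) |n|, sawtooth ((j : ℝ) / |n|) * sawtooth ((j * k : ℝ) / n)

/-- `L(τ) = πiτ/12 − Σ_{n≥1} (σ(n)/n) e^{2πinτ}`, the branch of `log η` that is real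
on the positive imaginary axis. -/
noncomputable def Leta (τ : ℂ) : ℂ :=
  Real.pi * Complex.I * τ / 12 -
    ∑' n : ℕ, ((∑ d ∈ (n + 1).divisors, d : ℕ) : ℂ) / (n + 1) *
      Complex.exp (2 * Real.pi * Complex.I * (n + 1) * τ)

theorem saw_of_int (z : ℤ) : sawtooth (z : ℝ) = 0 := by
  unfold sawtooth; rw [if_pos ⟨z, rfl⟩]

theorem saw_add_int (x : ℝ) (z : ℤ) : sawtooth (x + z) = sawtooth x := by
  unfold sawtooth
  have : (∃ w : ℤ, (w : ℝ) = x + z) ↔ (∃ w : ℤ, (w : ℝ) = x) := by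
    constructor
    · rintro ⟨w, hw⟩; exact ⟨w - z, by push_cast; linarith⟩
    · rintro ⟨w, hw⟩; exact ⟨w + z, by push_cast; linarith⟩
  rw [Int.floor_add_intCast]
  by_cases h : ∃ w : ℤ, (w : ℝ) = x
  · rw [if_pos h, if_pos (this.2 h)]
  · rw [if_neg h, if_neg (fun h' => h (this.1 h'))]
    push_cast; ring

theorem saw_neg (x : ℝ) : sawtooth (-x) = - sawtooth x := by
  by_cases h : ∃ w : ℤ, (w : ℝ) = x
  · obtain ⟨w, rfl⟩ := h
    rw [← Int.cast_neg, saw_of_int, saw_of_int, neg_zero]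
  · have h' : ¬ ∃ w : ℤ, (w : ℝ) = -x := by
      rintro ⟨w, hw⟩; exact h ⟨-w, by push_cast; linarith⟩
    unfold sawtooth
    rw [if_neg h, if_neg h']
    have : ⌊-x⌋ = -⌊x⌋ - 1 := by
      rw [Int.floor_eq_iff]
      push_cast
      have h1 := Int.floor_le x
      have h2 := Int.lt_floor_add_one x
      have h3 : (⌊x⌋ : ℝ) ≠ x := fun e => h ⟨_, e⟩
      have h4 := lt_of_le_of_ne h1 h3
      constructor <;> linarith
    rw [this]; push_cast; ring

theorem saw_frac (m n : ℕ) (hn : 0 < n) (h : ¬ n ∣ m) :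
    sawtooth ((m : ℝ) / n) = ((m % n : ℕ) : ℝ) / n - 1 / 2 := by
  have hn' : (0 : ℝ) < n := by exact_mod_cast hn
  have e : (m : ℝ) = n * (m / n : ℕ) + (m % n : ℕ) := by
    exact_mod_cast (Nat.div_add_mod m n).symm
  have e2 : (m : ℝ) / n = ((m % n : ℕ) : ℝ) / n + ((m / n : ℕ) : ℤ) := by
    rw [e, add_div, mul_div_cancel_left₀ _ hn'.ne', add_comm, Int.cast_natCast]
  rw [e2, saw_add_int]
  have hlt : ((m % n : ℕ) : ℝ) / n < 1 := by
    rw [div_lt_one hn']; exact_mod_cast Nat.mod_lt m hn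
  have hpos : 0 < ((m % n : ℕ) : ℝ) / n := by
    apply div_pos _ hn'
    exact_mod_cast Nat.pos_of_ne_zero (fun h0 => h (Nat.dvd_of_mod_eq_zero h0))
  have hf : ⌊((m % n : ℕ) : ℝ) / n⌋ = 0 := by
    rw [Int.floor_eq_iff]; simp only [Int.cast_zero, zero_add]; exact ⟨hpos.le, hlt⟩
  unfold sawtooth
  rw [if_neg, hf]
  · simp
  · rintro ⟨w, hw⟩
    rw [← hw] at hlt hpos
    have h1 : w < 1 := by exact_mod_cast hlt
    have h2 : 0 < w := by exact_mod_cast hpos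
    omega

theorem ds_add (d c q : ℤ) (hc : c ≠ 0) : dedekindSum (d + q * c) c = dedekindSum d c := by
  unfold dedekindSum
  refine Finset.sum_congr rfl fun j _ => ?_
  congr 1
  have hc' : (c : ℝ) ≠ 0 := by exact_mod_cast hc
  rw [← saw_add_int ((j * d : ℝ) / c) (j * q)]
  congr 1
  push_cast; field_simp

theorem ds_neg (d c : ℤ) : dedekindSum (-d) c = - dedekindSum d c := by
  unfold dedekindSum
  rw [← Finset.sum_neg_distrib]
  refine Finset.sum_congr rfl fun j _ => ?_
  rw [← mul_neg, ← saw_neg]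
  congr 2
  push_cast; ring

theorem ds_neg_neg (d c : ℤ) : dedekindSum (-d) (-c) = dedekindSum d c := by
  unfold dedekindSum
  rw [abs_neg]
  refine Finset.sum_congr rfl fun j _ => ?_
  congr 2
  push_cast; rw [mul_neg, neg_div_neg_eq]

theorem ds_nat (h k : ℕ) (hk : 0 < k) (hc : Nat.Coprime h k) :
    dedekindSum h k = -1 / 4 + ∑ j ∈ Finset.range k,
      ((j : ℝ) / k - 1 / 2) * (((h * j % k : ℕ) : ℝ) / k - 1 / 2) := by
  obtain ⟨n, rfl⟩ : ∃ n, k = n + 1 := ⟨k - 1, by omega⟩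
  rw [Finset.sum_range_succ']
  have : dedekindSum h (n + 1 : ℕ) = ∑ j ∈ Finset.range n,
      (((j + 1 : ℕ) : ℝ) / (n + 1 : ℕ) - 1 / 2) *
        (((h * (j + 1) % (n + 1) : ℕ) : ℝ) / (n + 1 : ℕ) - 1 / 2) := by
    unfold dedekindSum
    symm
    refine Finset.sum_bij (fun j _ => ((j + 1 : ℕ) : ℤ)) ?_ ?_ ?_ ?_
    · intro j hj
      simp only [Finset.mem_range] at hj
      simp only [Finset.mem_Ioo, Nat.abs_cast]
      omega
    · intro a _ b _ hab
      have : a + 1 = b + 1 := by exact_mod_cast hab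
      omega
    · intro b hb
      simp only [Finset.mem_Ioo, Nat.abs_cast] at hb
      refine ⟨b.toNat - 1, ?_, ?_⟩
      · simp only [Finset.mem_range]; omega
      · omega
    · intro j hj
      simp only [Finset.mem_range] at hj
      have n1 : ¬ (n + 1) ∣ (j + 1) := fun hd => by
        have := Nat.le_of_dvd (by omega) hd; omega
      have n2 : ¬ (n + 1) ∣ h * (j + 1) := fun hd => n1 (hc.symm.dvd_of_dvd_mul_left hd)
      have s1 := saw_frac (j + 1) (n + 1) (by omega) n1
      have s2 := saw_frac (h * (j + 1)) (n + 1) (by omega) n2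
      rw [Nat.mod_eq_of_lt (by omega)] at s1
      rw [← s1, ← s2, Nat.abs_cast]
      congr 2
      push_cast; ring
  rw [this]
  simp
  ring

theorem perm_sum (h k : ℕ) (hk : 0 < k) (hc : Nat.Coprime h k) (φ : ℕ → ℝ) :
    ∑ j ∈ Finset.range k, φ (h * j % k) = ∑ j ∈ Finset.range k, φ j := by
  have hmaps : ∀ j ∈ Finset.range k, h * j % k ∈ Finset.range k := fun j _ =>
    Finset.mem_range.2 (Nat.mod_lt _ hk)
  have hinj : Set.InjOn (fun j => h * j % k) (Finset.range k : Set ℕ) := by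
    intro a ha b hb hab
    simp only [Finset.coe_range, Set.mem_Iio] at ha hb
    have h1 : h * a ≡ h * b [MOD k] := hab
    have h2 : a ≡ b [MOD k] := Nat.ModEq.cancel_left_of_coprime (by simpa [Nat.coprime_comm] using hc) h1
    exact Nat.ModEq.eq_of_lt_of_lt h2 ha hb
  have himg : (Finset.range k).image (fun j => h * j % k) = Finset.range k := by
    apply Finset.eq_of_subset_of_card_le
    · intro x hx
      obtain ⟨j, hj, rfl⟩ := Finset.mem_image.1 hx
      exact hmaps j hj
    · rw [Finset.card_image_of_injOn hinj]
  conv_rhs => rw [← himg]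
  rw [Finset.sum_image hinj]

theorem sum_id_real (k : ℕ) : ∑ j ∈ Finset.range k, (j : ℝ) = k * (k - 1) / 2 := by
  induction k with
  | zero => simp
  | succ n ih => rw [Finset.sum_range_succ, ih]; push_cast; ring

theorem sum_sq_real (k : ℕ) : ∑ j ∈ Finset.range k, (j : ℝ) ^ 2 = k * (k - 1) * (2 * k - 1) / 6 := by
  induction k with
  | zero => simp
  | succ n ih => rw [Finset.sum_range_succ, ih]; push_cast; ring

theorem count_sum (h k : ℕ) (hh : 0 < h) (hk : 0 < k) (hc : Nat.Coprime h k) :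
    ∑ j ∈ Finset.range k, ((h * j / k : ℕ) : ℝ) * ((h * j / k : ℕ) + 1) =
      2 * ∑ i ∈ Finset.range h, (i : ℝ) * ((k : ℝ) - 1 - (k * i / h : ℕ)) := by
  have e1 : ∀ j ∈ Finset.range k, ((h * j / k : ℕ) : ℝ) * ((h * j / k : ℕ) + 1) =
      2 * ∑ i ∈ Finset.range h, if i * k ≤ h * j then (i : ℝ) else 0 := by
    intro j hj
    rw [Finset.mem_range] at hj
    rw [← Finset.sum_filter]
    have : (Finset.range h).filter (fun i => i * k ≤ h * j) = Finset.range (h * j / k + 1) := by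
      ext i
      simp only [Finset.mem_filter, Finset.mem_range, Nat.lt_succ_iff]
      rw [Nat.le_div_iff_mul_le hk]
      constructor
      · exact fun h => h.2
      · intro h1
        refine ⟨?_, h1⟩
        by_contra h2
        push Not at h2
        have h3 : h * k ≤ i * k := Nat.mul_le_mul_right k h2
        have h4 : h * j < h * k := Nat.mul_lt_mul_of_pos_left hj hh
        omega
    rw [this, sum_id_real]; push_cast; ring
  rw [Finset.sum_congr rfl e1, ← Finset.mul_sum, Finset.sum_comm]
  congr 1
  refine Finset.sum_congr rfl fun i hi => ?_
  rw [Finset.mem_range] at hi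
  rcases Nat.eq_zero_or_pos i with rfl | hi0
  · simp
  rw [← Finset.sum_filter, Finset.sum_const, nsmul_eq_mul, mul_comm]
  congr 1
  have c1 : (Finset.range k).filter (fun j => ¬ i * k ≤ h * j) = Finset.range (k * i / h + 1) := by
    ext j
    simp only [Finset.mem_filter, Finset.mem_range, Nat.lt_succ_iff, not_le]
    rw [Nat.le_div_iff_mul_le hh]
    constructor
    · intro h1; nlinarith [h1.2]
    · intro h1
      have h2 : j < k := by
        by_contra h2
        push Not at h2
        have h3 : k * h ≤ j * h := Nat.mul_le_mul_right h h2
        have h4 : k * i < k * h := Nat.mul_lt_mul_of_pos_left hi hk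
        omega
      refine ⟨h2, ?_⟩
      have h3 : h * j ≠ i * k := by
        intro he
        have : h ∣ i := hc.dvd_of_dvd_mul_right (Dvd.intro _ he)
        have := Nat.le_of_dvd hi0 this
        omega
      have h4 : h * j ≤ i * k := by nlinarith
      omega
  have c2 := Finset.card_filter_add_card_filter_not (s := Finset.range k) (fun j => i * k ≤ h * j)
  rw [c1, Finset.card_range, Finset.card_range] at c2
  have c3 : (((Finset.range k).filter (fun j => i * k ≤ h * j)).card : ℝ) + ((k * i / h : ℕ) + 1) = k := by
    exact_mod_cast c2
  linarith

theorem mod_real (h k j : ℕ) : ((h * j % k : ℕ) : ℝ) = h * j - k * (h * j / k : ℕ) := by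
  have : ((k * (h * j / k) + h * j % k : ℕ) : ℝ) = ((h * j : ℕ) : ℝ) := by
    rw [Nat.div_add_mod]
  push_cast at this ⊢
  linarith

/-- `S(h,k)` in terms of `∑ j⌊hj/k⌋`. -/
theorem ds_floor (h k : ℕ) (hk : 0 < k) (hc : Nat.Coprime h k) :
    dedekindSum h k = -1 / 4 + h * ((k - 1) * (2 * k - 1) / 6) / k
      - (∑ j ∈ Finset.range k, (j : ℝ) * (h * j / k : ℕ)) / k - (k - 1) / 2 + k / 4 := by
  rw [ds_nat h k hk hc]
  have hk' : (k : ℝ) ≠ 0 := by exact_mod_cast hk.ne'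
  have p1 := perm_sum h k hk hc (fun n => (n : ℝ))
  rw [sum_id_real] at p1
  have : ∀ j ∈ Finset.range k, ((j : ℝ) / k - 1 / 2) * (((h * j % k : ℕ) : ℝ) / k - 1 / 2) =
      (h / k ^ 2) * (j : ℝ) ^ 2 - (1 / k) * ((j : ℝ) * (h * j / k : ℕ)) - (1 / (2 * k)) * j
        - (1 / (2 * k)) * (h * j % k : ℕ) + 1 / 4 := by
    intro j _
    have := mod_real h k j
    have e : ((j : ℝ) / k - 1 / 2) * (((h * j % k : ℕ) : ℝ) / k - 1 / 2) =
      (j : ℝ) / k ^ 2 * (h * j % k : ℕ) - (1 / (2 * k)) * j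
        - (1 / (2 * k)) * (h * j % k : ℕ) + 1 / 4 := by field_simp; ring
    have e3 : (j : ℝ) / k ^ 2 * (h * j % k : ℕ) = 
       (h / k ^ 2) * (j : ℝ) ^ 2 - (1 / k) * ((j : ℝ) * (h * j / k : ℕ)) := by
      rw [this]; field_simp
    rw [e, e3]
  rw [Finset.sum_congr rfl this]
  simp only [Finset.sum_add_distrib, Finset.sum_sub_distrib, ← Finset.mul_sum, p1, sum_id_real,
    sum_sq_real, Finset.sum_const, Finset.card_range, nsmul_eq_mul]
  field_simp
  ring

theorem reciprocity (h k : ℕ) (hh : 0 < h) (hk : 0 < k) (hc : Nat.Coprime h k) :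
    12 * (dedekindSum h k + dedekindSum k h) =
      -3 + (h : ℝ) / k + (k : ℝ) / h + 1 / (h * k) := by
  rw [ds_floor h k hk hc, ds_floor k h hh hc.symm]
  have hk' : (k : ℝ) ≠ 0 := by exact_mod_cast hk.ne'
  have hh' : (h : ℝ) ≠ 0 := by exact_mod_cast hh.ne'
  have p1 := perm_sum h k hk hc (fun n => (n : ℝ))
  have p2 := perm_sum h k hk hc (fun n => (n : ℝ) ^ 2)
  have p3 := count_sum h k hh hk hc
  simp only [mod_real, sub_sq, mul_pow, mul_add, mul_sub, mul_one, Finset.sum_add_distrib,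
    Finset.sum_sub_distrib, ← Finset.mul_sum, ← Finset.sum_mul, sum_id_real, sum_sq_real] at p1 p2 p3
  set Jf := ∑ j ∈ Finset.range k, (j : ℝ) * (h * j / k : ℕ) with hJf
  set Jg := ∑ j ∈ Finset.range h, (j : ℝ) * (k * j / h : ℕ) with hJg
  set F1 := ∑ j ∈ Finset.range k, ((h * j / k : ℕ) : ℝ)
  set F2 := ∑ j ∈ Finset.range k, ((h * j / k : ℕ) : ℝ) ^ 2
  have e1 : ∑ j ∈ Finset.range k, 2 * ((h : ℝ) * j) * (k * (h * j / k : ℕ)) = 2 * h * k * Jf := by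
    rw [hJf, Finset.mul_sum]; exact Finset.sum_congr rfl fun j _ => by ring
  have e2 : ∑ j ∈ Finset.range k, ((h * j / k : ℕ) : ℝ) * (h * j / k : ℕ) = F2 :=
    Finset.sum_congr rfl fun j _ => by ring
  rw [e1] at p2
  rw [e2] at p3
  field_simp
  have q1 : F1 = (h - 1) * (k - 1) / 2 := by
    field_simp
    have := mul_left_cancel₀ hk' (show (k : ℝ) * (2 * F1) = k * ((h - 1) * (k - 1)) by linarith)
    linarith
  have q2 : F2 = 2 * ((h * (h - 1) / 2) * k - (h * (h - 1) / 2) - Jg) - F1 := by linarith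
  rw [q2, q1] at p2
  have := mul_left_cancel₀ hk' (show (k : ℝ) * (2 * h * Jf) = k * ((h ^ 2 - 1) * ((k - 1) * (2 * k - 1) / 6) + k * (2 * ((h * (h - 1) / 2) * k - (h * (h - 1) / 2) - Jg) - (h - 1) * (k - 1) / 2)) by linarith)
  have q3 : Jf * h = ((h ^ 2 - 1) * ((k - 1) * (2 * k - 1) / 6) + k * (2 * ((h * (h - 1) / 2) * k - (h * (h - 1) / 2) - Jg) - (h - 1) * (k - 1) / 2)) / 2 := by linarith
  linear_combination (-576 : ℝ) * q3

open UpperHalfPlane EisensteinSeries in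
theorem Leta_hasDerivAt (z : ℍ) :
    HasDerivAt Leta (Real.pi * Complex.I / 12 * E2 z) (z : ℂ) := by
  set y0 : ℝ := (z : ℂ).im / 2 with hy0
  have hzim : 0 < (z : ℂ).im := z.2
  have hy0pos : 0 < y0 := by rw [hy0]; linarith
  set r : ℝ := Real.exp (-(2 * Real.pi * y0)) with hr
  have hr0 : 0 ≤ r := (Real.exp_pos _).le
  have hr1 : r < 1 := by
    rw [hr, Real.exp_lt_one_iff]
    have := Real.pi_pos
    have : 0 < 2 * Real.pi * y0 := by positivity
    linarith
  have hsum : Summable (fun n : ℕ => (2 * Real.pi) * (((n + 1 : ℕ) : ℝ) ^ 2 * r ^ (n + 1))) := by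
    apply Summable.mul_left
    have := summable_pow_mul_geometric_of_norm_lt_one (R := ℝ) 2 (r := r)
      (by rwa [Real.norm_of_nonneg hr0])
    exact (summable_nat_add_iff (f := fun n : ℕ => ((n : ℝ) ^ 2 * r ^ n)) 1).2 this
  have hsig : ∀ n : ℕ, ((∑ d ∈ (n + 1).divisors, d : ℕ) : ℝ) ≤ ((n + 1 : ℕ) : ℝ) ^ 2 := by
    intro n
    have := ArithmeticFunction.sigma_le_pow_succ 1 (n + 1)
    rw [ArithmeticFunction.sigma_one_apply] at this
    exact_mod_cast this
  have hexp : ∀ (n : ℕ) (y : ℂ), y0 < y.im →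
      ‖Complex.exp (2 * Real.pi * Complex.I * (n + 1) * y)‖ ≤ r ^ (n + 1) := by
    intro n y hy
    rw [Complex.norm_exp, hr, ← Real.exp_nat_mul]
    apply Real.exp_le_exp.2
    have : (2 * Real.pi * Complex.I * (n + 1) * y : ℂ).re = -(2 * Real.pi * (n + 1) * y.im) := by
      have : (2 * Real.pi * Complex.I * (n + 1) * y : ℂ) =
        ((2 * Real.pi * (n + 1) : ℝ) : ℂ) * (Complex.I * y) := by push_cast; ring
      rw [this, Complex.re_ofReal_mul]; simp
    rw [this]
    push_cast
    have h2 : 0 < 2 * Real.pi * ((n : ℝ) + 1) := by have := Real.pi_pos; positivity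
    nlinarith
  have hmem : (z : ℂ) ∈ {y : ℂ | y0 < y.im} := by
    show y0 < (z : ℂ).im
    rw [hy0]; linarith
  have hopen : IsOpen {y : ℂ | y0 < y.im} := isOpen_lt continuous_const Complex.continuous_im
  have hconn : IsPreconnected {y : ℂ | y0 < y.im} := (convex_halfSpace_im_gt y0).isPreconnected
  have hterm : ∀ (n : ℕ) (y : ℂ), y0 < y.im →
      ‖((∑ d ∈ (n + 1).divisors, d : ℕ) : ℂ) * Complex.exp (2 * Real.pi * Complex.I * (n + 1) * y)‖
        ≤ ((n + 1 : ℕ) : ℝ) ^ 2 * r ^ (n + 1) := by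
    intro n y hy
    rw [norm_mul, Complex.norm_natCast]
    exact mul_le_mul (hsig n) (hexp n y hy) (norm_nonneg _) (by positivity)
  have hd := hasDerivAt_tsum_of_isPreconnected
    (g := fun (n : ℕ) (y : ℂ) => ((∑ d ∈ (n + 1).divisors, d : ℕ) : ℂ) / (n + 1) *
      Complex.exp (2 * Real.pi * Complex.I * (n + 1) * y))
    (g' := fun (n : ℕ) (y : ℂ) => 2 * Real.pi * Complex.I * (((∑ d ∈ (n + 1).divisors, d : ℕ) : ℂ) *
      Complex.exp (2 * Real.pi * Complex.I * (n + 1) * y)))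
    (y₀ := (z : ℂ)) (y := (z : ℂ)) hsum hopen hconn ?_ ?_ hmem ?_ hmem
  · have h1 : HasDerivAt (fun τ : ℂ => Real.pi * Complex.I * τ / 12) (Real.pi * Complex.I / 12) (z : ℂ) := by
      have := ((hasDerivAt_id (z : ℂ)).const_mul (Real.pi * Complex.I : ℂ)).div_const 12
      simpa using this
    have h2 := h1.sub hd
    have e : (Real.pi * Complex.I / 12 * E2 z : ℂ) = Real.pi * Complex.I / 12 -
        ∑' n : ℕ, 2 * Real.pi * Complex.I * (((∑ d ∈ (n + 1).divisors, d : ℕ) : ℂ) *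
      Complex.exp (2 * Real.pi * Complex.I * (n + 1) * z)) := by
      rw [E2_eq_tsum_cexp, tsum_pnat_eq_tsum_succ (f := fun n : ℕ =>
        (ArithmeticFunction.sigma 1 n : ℂ) * Complex.exp (2 * Real.pi * Complex.I * z) ^ n),
        tsum_mul_left]
      have : ∀ n : ℕ, (ArithmeticFunction.sigma 1 (n + 1) : ℂ) *
          Complex.exp (2 * Real.pi * Complex.I * z) ^ (n + 1) =
          ((∑ d ∈ (n + 1).divisors, d : ℕ) : ℂ) *
            Complex.exp (2 * Real.pi * Complex.I * (n + 1) * z) := by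
        intro n
        rw [ArithmeticFunction.sigma_one_apply, ← Complex.exp_nat_mul]
        congr 2
        push_cast; ring
      simp only [this]
      ring
    rw [e]
    exact h2
  · intro n y _
    have := (((hasDerivAt_id y).const_mul (2 * Real.pi * Complex.I * (n + 1) : ℂ)).cexp).const_mul
      (((∑ d ∈ (n + 1).divisors, d : ℕ) : ℂ) / (n + 1))
    refine this.congr_deriv ?_
    have : (n + 1 : ℂ) ≠ 0 := by exact_mod_cast Nat.succ_ne_zero n
    simp only [id]
    field_simp
  · intro n y hy
    rw [norm_mul]
    have : ‖(2 * Real.pi * Complex.I : ℂ)‖ = 2 * Real.pi := by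
      simp [abs_of_pos Real.pi_pos]
    rw [this]
    exact mul_le_mul_of_nonneg_left (hterm n y hy) (by have := Real.pi_pos; positivity)
  · refine Summable.of_norm_bounded (g := fun n : ℕ => (((n + 1 : ℕ) : ℝ) ^ 2 * r ^ (n + 1))) ?_ ?_
    · have := hsum.mul_left (1 / (2 * Real.pi))
      refine this.congr fun n => ?_
      have := Real.pi_pos.ne'
      field_simp
    · intro n
      refine le_trans ?_ (hterm n z hmem)
      rw [norm_mul, norm_mul]
      apply mul_le_mul_of_nonneg_right _ (norm_nonneg _)
      rw [norm_div]
      apply div_le_self (norm_nonneg _)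
      have : ((n : ℂ) + 1) = ((n + 1 : ℕ) : ℂ) := by push_cast; rfl
      rw [this, Complex.norm_natCast]
      push_cast
      have : (0 : ℝ) ≤ n := Nat.cast_nonneg n
      linarith

theorem im_neg_one_div_pos {z : ℂ} (hz : 0 < z.im) : 0 < (-1 / z).im := by
  have h0 : z ≠ 0 := by rintro rfl; simp at hz
  rw [neg_div, one_div, Complex.neg_im, Complex.inv_im, neg_div, neg_neg]
  exact div_pos hz (Complex.normSq_pos.2 h0)

open UpperHalfPlane EisensteinSeries in
theorem E2_S (z w : ℍ) (h : (w : ℂ) = -1 / (z : ℂ)) :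
    E2 w = (z : ℂ) ^ 2 * E2 z - 6 * Complex.I * z / Real.pi := by
  have h0 : (z : ℂ) ≠ 0 := z.ne_zero
  have hw : w = ModularGroup.S • z := by
    ext
    rw [h, modular_S_smul]
    simp [neg_div, inv_neg]
  have hG := G2_S_transform z
  rw [← hw] at hG
  have hG' : G2 w = (z : ℂ) ^ 2 * G2 z - 2 * Real.pi * Complex.I * z := by
    rw [hG]; field_simp; ring
  have hpi : (Real.pi : ℂ) ≠ 0 := by exact_mod_cast Real.pi_pos.ne'
  simp only [E2, Pi.smul_apply, smul_eq_mul, riemannZeta_two, hG']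
  field_simp

theorem Leta_S {τ : ℂ} (hτ : 0 < τ.im) :
    Leta (-1 / τ) = Leta τ + (1 / 2) * (Complex.log τ - Real.pi * Complex.I / 2) := by
  let F : ℂ → ℂ := fun z => Leta (-1 / z) - Leta z - (1 / 2) * Complex.log z
  have hF : ∀ z ∈ {z : ℂ | 0 < z.im}, HasDerivAt F 0 z := by
    intro z hz
    have hz' : 0 < z.im := hz
    have h0 : z ≠ 0 := by rintro rfl; simp at hz'
    have hi := im_neg_one_div_pos hz'
    have d1 := Leta_hasDerivAt ⟨z, hz'⟩
    have d2 := Leta_hasDerivAt ⟨-1 / z, hi⟩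
    have d3 : HasDerivAt (fun z : ℂ => -1 / z) (1 / z ^ 2) z := by
      have := (hasDerivAt_inv h0).const_mul (-1 : ℂ)
      refine (this.congr_deriv ?_)
      simp
    have d4 := HasDerivAt.comp z d2 d3
    have d5 : HasDerivAt Complex.log z⁻¹ z :=
      Complex.hasDerivAt_log (Or.inr hz'.ne')
    have d6 := (d4.sub d1).sub (d5.const_mul (1 / 2))
    refine d6.congr_deriv ?_
    rw [E2_S ⟨z, hz'⟩ ⟨-1 / z, hi⟩ rfl]
    have hpi : (Real.pi : ℂ) ≠ 0 := by exact_mod_cast Real.pi_pos.ne'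
    show Real.pi * Complex.I / 12 * (z ^ 2 * _ - 6 * Complex.I * z / Real.pi) * (1 / z ^ 2) - _ - _ = (0 : ℂ)
    field_simp
    ring_nf
    rw [Complex.I_sq]; ring
  have hopen : IsOpen {z : ℂ | 0 < z.im} := isOpen_lt continuous_const Complex.continuous_im
  have hconn : IsPreconnected {z : ℂ | 0 < z.im} := (convex_halfSpace_im_gt 0).isPreconnected
  have hc := hopen.is_const_of_deriv_eq_zero hconn
    (fun z hz => (hF z hz).differentiableAt.differentiableWithinAt)
    (fun z hz => (hF z hz).deriv) (x := τ) (y := Complex.I) hτ (by simp)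
  simp only [F, Complex.log_I] at hc
  have : (-1 / Complex.I) = Complex.I := by
    rw [div_eq_iff Complex.I_ne_zero, Complex.I_mul_I]
  rw [this] at hc
  linear_combination hc

theorem Leta_add_int (τ : ℂ) (q : ℤ) : Leta (τ + q) = Leta τ + Real.pi * Complex.I / 12 * q := by
  unfold Leta
  have : ∀ n : ℕ, Complex.exp (2 * Real.pi * Complex.I * (n + 1) * (τ + q)) =
      Complex.exp (2 * Real.pi * Complex.I * (n + 1) * τ) := by
    intro n
    rw [Complex.exp_eq_exp_iff_exists_int]
    exact ⟨(n + 1) * q, by push_cast; ring⟩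
  simp only [this]
  ring

theorem log_neg_sq {w : ℂ} (hw : 0 < w.im) :
    Complex.log (-w ^ 2) = 2 * Complex.log w - Real.pi * Complex.I := by
  have h0 : w ≠ 0 := by rintro rfl; simp at hw
  have harg : 0 < w.arg ∧ w.arg < Real.pi := by
    have h1 := Complex.arg_nonneg_iff.2 hw.le
    have h2 := Complex.arg_le_pi w
    refine ⟨lt_of_le_of_ne h1 ?_, lt_of_le_of_ne h2 ?_⟩
    · intro h; exact hw.ne' (Complex.arg_eq_zero_iff.1 h.symm).2
    · intro h; exact hw.ne' (Complex.arg_eq_pi_iff.1 h).2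
  have e : -w ^ 2 = Complex.exp (2 * Complex.log w - Real.pi * Complex.I) := by
    rw [Complex.exp_sub, Complex.exp_pi_mul_I, two_mul, Complex.exp_add, Complex.exp_log h0]
    ring
  have him : (2 * Complex.log w - Real.pi * Complex.I).im = 2 * w.arg - Real.pi := by
    simp [Complex.log_im]
  rw [e, Complex.log_exp]
  · rw [him]; linarith
  · rw [him]; linarith

theorem log_mul_neg {w₁ w₂ w₃ : ℂ} (h1 : 0 < w₁.im) (h2 : 0 < w₂.im) (h3 : w₁ * w₂ = -w₃) :
    Complex.log w₁ + Complex.log w₂ = Complex.log w₃ + Real.pi * Complex.I := by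
  have harg : ∀ {w : ℂ}, 0 < w.im → w ≠ 0 ∧ 0 < w.arg ∧ w.arg < Real.pi := by
    intro w hw
    have h1 := Complex.arg_nonneg_iff.2 hw.le
    have h2 := Complex.arg_le_pi w
    refine ⟨by rintro rfl; simp at hw, lt_of_le_of_ne h1 ?_, lt_of_le_of_ne h2 ?_⟩
    · intro h; exact hw.ne' (Complex.arg_eq_zero_iff.1 h.symm).2
    · intro h; exact hw.ne' (Complex.arg_eq_pi_iff.1 h).2
  obtain ⟨n1, a1, b1⟩ := harg h1
  obtain ⟨n2, a2, b2⟩ := harg h2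
  have e : w₃ = Complex.exp (Complex.log w₁ + Complex.log w₂ - Real.pi * Complex.I) := by
    rw [Complex.exp_sub, Complex.exp_pi_mul_I, Complex.exp_add, Complex.exp_log n1,
      Complex.exp_log n2, h3]
    ring
  have him : (Complex.log w₁ + Complex.log w₂ - Real.pi * Complex.I).im =
      w₁.arg + w₂.arg - Real.pi := by
    simp [Complex.log_im]
  rw [e, Complex.log_exp]
  · ring
  · rw [him]; linarith
  · rw [him]; linarith

theorem main_pos (n : ℕ) : ∀ (a b d : ℤ), a * d - b * (n : ℤ) = 1 → 0 < n →
    ∀ τ : ℂ, 0 < τ.im →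
    Leta (((a : ℂ) * τ + b) / (((n : ℤ) : ℂ) * τ + d)) =
      Leta τ + (1 / 4) * Complex.log (-(((n : ℤ) : ℂ) * τ + d) ^ 2) +
        Real.pi * Complex.I / 12 *
          (((a : ℂ) + d) / ((n : ℤ) : ℂ) - 12 * (dedekindSum d (n : ℤ) : ℝ)) := by
  induction n using Nat.strong_induction_on with
  | _ n ih =>
  intro a b d hdet hn τ hτ
  rcases Nat.eq_or_lt_of_le (show 1 ≤ n from hn) with h1 | h1
  · -- `c = 1`
    subst h1
    have hds : dedekindSum d ((1 : ℕ) : ℤ) = 0 := by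
      unfold dedekindSum
      apply Finset.sum_eq_zero
      intro j hj
      simp only [Finset.mem_Ioo, Nat.cast_one, abs_one] at hj
      omega
    have him : 0 < (τ + d).im := by simpa using hτ
    have h0 : τ + d ≠ 0 := by intro h; rw [h] at him; simp at him
    have hb : (b : ℂ) = a * d - 1 := by
      have : b = a * d - 1 := by push_cast at hdet; linarith
      rw [this]; push_cast; ring
    have e : ((a : ℂ) * τ + b) / ((((1 : ℕ) : ℤ) : ℂ) * τ + d) = -1 / (τ + d) + a := by
      rw [hb]; push_cast; rw [one_mul]; field_simp; ring
    rw [e, Leta_add_int, Leta_S him, Leta_add_int, hds]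
    have e2 : ((((1 : ℕ) : ℤ) : ℂ) * τ + d) = τ + d := by push_cast; ring
    rw [e2, log_neg_sq him]
    push_cast
    ring
  · -- `c > 1`
    have hnz : (n : ℤ) ≠ 0 := by omega
    obtain ⟨r, hr⟩ : ∃ r : ℕ, (r : ℤ) = d % n := ⟨(d % n).toNat, by
      have := Int.emod_nonneg d hnz; omega⟩
    have hrn : r < n := by
      have := Int.emod_lt_of_pos d (show (0 : ℤ) < n by omega); omega
    set q : ℤ := d / n with hq
    have hdq : d = r + q * n := by
      have := Int.emod_add_mul_ediv d n
      rw [hr, hq]; linarith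
    have hdet' : a * r - (b - a * q) * n = 1 := by rw [hdq] at hdet; linarith
    have hcop : Nat.Coprime r n := by
      rw [← Nat.isCoprime_iff_coprime]
      exact ⟨a, -(b - a * q), by linarith⟩
    have hr0 : 0 < r := by
      rcases Nat.eq_zero_or_pos r with h | h
      · rw [h, Nat.coprime_zero_left] at hcop; omega
      · exact h
    have him : 0 < (τ + q).im := by simpa using hτ
    set t : ℂ := τ + q with ht
    have h0 : t ≠ 0 := by intro h; rw [h] at him; simp at him
    have him' := im_neg_one_div_pos him
    have IH := ih r hrn (b - a * q) (-a) (-(n : ℤ)) (by linarith) hr0 (-1 / t) him'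
    have w2im : 0 < (((r : ℤ) : ℂ) * (-1 / t) + (-(n : ℤ) : ℤ)).im := by
      have : (((r : ℤ) : ℂ) * (-1 / t) + (-(n : ℤ) : ℤ)).im = r * (-1 / t).im := by
        push_cast
        rw [Complex.add_im, ← Complex.ofReal_natCast r, Complex.im_ofReal_mul]; simp
      rw [this]
      have : (0 : ℝ) < r := by exact_mod_cast hr0
      positivity
    have w3im : 0 < (((n : ℤ) : ℂ) * t + (r : ℤ)).im := by
      have : (((n : ℤ) : ℂ) * t + (r : ℤ)).im = n * t.im := by
        push_cast
        rw [Complex.add_im, ← Complex.ofReal_natCast n, Complex.im_ofReal_mul]; simp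
      rw [this]
      have : (0 : ℝ) < n := by exact_mod_cast hn
      positivity
    have hw := log_mul_neg him w2im (w₃ := ((n : ℤ) : ℂ) * t + (r : ℤ)) (by
      push_cast; field_simp; ring)
    have hw3 : ((n : ℤ) : ℂ) * t + (r : ℤ) = ((n : ℤ) : ℂ) * τ + d := by
      rw [hdq, ht]; push_cast; ring
    have w2ne : ((r : ℤ) : ℂ) * (-1 / t) + (-(n : ℤ) : ℤ) ≠ 0 := by
      intro h; rw [h] at w2im; simp at w2im
    have w3ne : ((n : ℤ) : ℂ) * t + (r : ℤ) ≠ 0 := by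
      intro h; rw [h] at w3im; simp at w3im
    have hmob : (((b - a * q : ℤ) : ℂ) * (-1 / t) + (-a : ℤ)) /
        (((r : ℤ) : ℂ) * (-1 / t) + (-(n : ℤ) : ℤ)) =
        ((a : ℂ) * τ + b) / (((n : ℤ) : ℂ) * τ + d) := by
      rw [← hw3, div_eq_div_iff w2ne w3ne, ht]
      rw [ht] at h0
      push_cast
      field_simp
      ring
    rw [hmob] at IH
    rw [IH, Leta_S him, ht, Leta_add_int, ← ht, ← hw3, log_neg_sq w2im, log_neg_sq w3im, ds_neg]
    have hds : dedekindSum d (n : ℤ) = dedekindSum r (n : ℤ) := by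
      rw [hdq, ds_add _ _ _ hnz]
    have hrec := reciprocity r n hr0 hn hcop
    rw [hds]
    have hrec' : (12 * ((dedekindSum r n : ℝ) + (dedekindSum n r : ℝ)) : ℂ) =
      -3 + (r : ℂ) / n + (n : ℂ) / r + 1 / (r * n) := by
      have h := congrArg (fun x : ℝ => (x : ℂ)) hrec
      push_cast at h
      exact h
    have hrc : (r : ℂ) ≠ 0 := by exact_mod_cast hr0.ne'
    have hnc : (n : ℂ) ≠ 0 := by exact_mod_cast hn.ne'
    have hdetc : (a : ℂ) * r - (b - a * q) * n = 1 := by exact_mod_cast hdet'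
    have hfrac : ((a : ℂ) + r) / n - ((b - a * q) - n) / r = 1 / (r * n) + r / n + n / r := by
      field_simp
      linear_combination hdetc
    have hdc : ((a : ℂ) + d) / n = (a + r) / n + q := by
      rw [hdq]; push_cast; field_simp; ring
    push_cast at hw ⊢
    rw [hdc]
    linear_combination (1 / 2 : ℂ) * hw + (Real.pi * Complex.I / 12) * (hrec' - hfrac)

/-- The Dedekind functional equation (A.1) for `c ≠ 0`:
`L((aτ+b)/(cτ+d)) = L(τ) + ¼·Log(−(cτ+d)²) + (πi/12)((a+d)/c − 12·S(d,c))`,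
where `Log` is the principal branch of the logarithm. -/
theorem stmt9 (a b c d : ℤ) (hdet : a * d - b * c = 1) (hc : c ≠ 0)
    (τ : ℂ) (hτ : 0 < τ.im) :
    Leta (((a : ℂ) * τ + b) / ((c : ℂ) * τ + d)) =
      Leta τ + (1 / 4) * Complex.log (-((c : ℂ) * τ + d) ^ 2) +
        Real.pi * Complex.I / 12 *
          (((a : ℂ) + d) / c - 12 * (dedekindSum d c : ℝ)) := by

  rcases lt_or_gt_of_ne hc with h | h
  · obtain ⟨n, hn⟩ : ∃ n : ℕ, (n : ℤ) = -c := ⟨(-c).toNat, by omega⟩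
    have H := main_pos n (-a) (-b) (-d) (by rw [hn]; linarith) (by omega) τ hτ
    rw [hn, ds_neg_neg] at H
    have e1 : (((-a : ℤ) : ℂ) * τ + (-b : ℤ)) / (((-c : ℤ) : ℂ) * τ + (-d : ℤ)) =
        ((a : ℂ) * τ + b) / ((c : ℂ) * τ + d) := by
      rw [← neg_div_neg_eq]; congr 1 <;> (push_cast; ring)
    have e2 : (((-c : ℤ) : ℂ) * τ + (-d : ℤ)) ^ 2 = ((c : ℂ) * τ + d) ^ 2 := by
      push_cast; ring
    have e3 : (((-a : ℤ) : ℂ) + (-d : ℤ)) / ((-c : ℤ) : ℂ) = ((a : ℂ) + d) / c := by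
      rw [← neg_div_neg_eq]; congr 1 <;> (push_cast; ring)
    rw [e1, e2, e3] at H
    exact H
  · obtain ⟨n, hn⟩ : ∃ n : ℕ, (n : ℤ) = c := ⟨c.toNat, by omega⟩
    have H := main_pos n a b d (by rw [hn]; exact hdet) (by omega) τ hτ
    rw [hn] at H
    exact H
end

section
/- For positive real s, k ∈ ℕ, and ε coprime to k, define F_{k,ε}(s) = ∫₀^∞ ∫₀^s Σ_{m ≡ εn (mod k)} m·n·e^{−t(m² + n²a²)} da dt (sum over all integer pairs (m,n) with m ≡ εn mod k). Then F_{k,ε}(s) = 2·Im L((−ε* + i s^{−1})/k) + π ε*/(6k), where ε* is any integer with ε·ε* ≡ 1 (mod k) and L is the logarithm of the Dedekind eta function. -/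
open MeasureTheory

-- `F_{k,ε}(s) = ∫₀^∞ ∫₀^s Σ_{m ≡ εn (mod k)} m·n·e^{−t(m² + n²a²)} da dt`,
-- the sum running over all pairs `(m, n) ∈ ℤ²` with `m ≡ εn (mod k)` (Definition 2.10).
open Classical in
noncomputable def Fke (k : ℕ) (ε : ℤ) (s : ℝ) : ℝ :=
  ∫ t in Set.Ioi (0 : ℝ), ∫ a in Set.Ioo (0 : ℝ) s,
    ∑' mn : ℤ × ℤ,
      if mn.1 ≡ ε * mn.2 [ZMOD (k : ℤ)] then
        (mn.1 * mn.2 : ℝ) * Real.exp (-t * ((mn.1 : ℝ) ^ 2 + (mn.2 : ℝ) ^ 2 * a ^ 2))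
      else 0

open MeasureTheory Filter Topology

noncomputable def Efn (x : ℝ) : ℝ := ∫ u in (0:ℝ)..x, Real.exp (-u ^ 2)

lemma Efn_hasDeriv (x : ℝ) : HasDerivAt Efn (Real.exp (-x ^ 2)) x := by
  have hc : Continuous (fun u : ℝ => Real.exp (-u ^ 2)) := by fun_prop
  exact intervalIntegral.integral_hasDerivAt_right (hc.intervalIntegrable _ _)
    hc.aestronglyMeasurable.stronglyMeasurableAtFilter hc.continuousAt

lemma Efn_top : Tendsto Efn atTop (𝓝 (√Real.pi / 2)) := by
  have h := integral_gaussian_Ioi 1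
  have hi : IntegrableOn (fun u : ℝ => Real.exp (-1 * u ^ 2)) (Set.Ioi 0) :=
    (integrable_exp_neg_mul_sq one_pos).integrableOn
  have h2 := intervalIntegral_tendsto_integral_Ioi 0 hi tendsto_id
  rw [h] at h2
  simpa [Efn, Function.comp_def] using! h2

lemma Efn_neg (x : ℝ) : Efn (-x) = - Efn x := by
  unfold Efn
  have := intervalIntegral.integral_comp_neg (a := 0) (b := x) (fun u : ℝ => Real.exp (-u ^ 2))
  simp only [neg_zero, even_two, Even.neg_pow] at this
  rw [this, intervalIntegral.integral_symm]

lemma Efn_bot : Tendsto Efn atBot (𝓝 (-(√Real.pi / 2))) := by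
  have := (Efn_top.comp tendsto_neg_atBot_atTop).neg
  refine this.congr fun x => ?_
  simp [Efn_neg]

/-- the primitive -/
noncomputable def Psi (α β t : ℝ) : ℝ :=
  Real.exp (-(2 * α * β)) * Efn (β * √t - α / √t) - Real.exp (2 * α * β) * Efn (β * √t + α / √t)

lemma Psi_deriv {α β t : ℝ} (ht : 0 < t) :
    HasDerivAt (Psi α β) (α / (t * √t) * Real.exp (-(β ^ 2 * t + α ^ 2 / t))) t := by
  have hs : 0 < √t := Real.sqrt_pos.2 ht
  have hsq : √t ^ 2 = t := Real.sq_sqrt ht.le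
  have h1 : HasDerivAt (fun t => √t) (1 / (2 * √t)) t := Real.hasDerivAt_sqrt ht.ne'
  have h2 : HasDerivAt (fun t => α / √t) (-(α / (2 * √t ^ 3))) t := by
    have := (h1.inv hs.ne').const_mul α
    convert! this using 1
    field_simp
  have hp := (Efn_hasDeriv (β * √t - α / √t)).comp t ((h1.const_mul β).sub h2)
  have hq := (Efn_hasDeriv (β * √t + α / √t)).comp t ((h1.const_mul β).add h2)
  have := (hp.const_mul (Real.exp (-(2 * α * β)))).sub (hq.const_mul (Real.exp (2 * α * β)))
  convert! this using 1
  have e1 : Real.exp (-(2 * α * β)) * Real.exp (-(β * √t - α / √t) ^ 2)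
      = Real.exp (-(β ^ 2 * t + α ^ 2 / t)) := by
    rw [← Real.exp_add]; congr 1
    rw [← hsq]; field_simp; rw [Real.sqrt_sq hs.le]; ring
  have e2 : Real.exp ((2 * α * β)) * Real.exp (-(β * √t + α / √t) ^ 2)
      = Real.exp (-(β ^ 2 * t + α ^ 2 / t)) := by
    rw [← Real.exp_add]; congr 1
    rw [← hsq]; field_simp; rw [Real.sqrt_sq hs.le]; ring
  rw [← mul_assoc, ← mul_assoc, e1, e2]
  rw [show t * √t = √t ^ 3 by rw [pow_succ, hsq]]
  field_simp
  ring

lemma sqrt_tendsto_zero : Tendsto (fun t : ℝ => √t) (𝓝[>] 0) (𝓝[>] 0) := by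
  apply tendsto_nhdsWithin_of_tendsto_nhds_of_eventually_within
  · have := Real.continuous_sqrt.tendsto 0
    rw [Real.sqrt_zero] at this
    exact this.mono_left nhdsWithin_le_nhds
  · filter_upwards [self_mem_nhdsWithin] with t ht using Real.sqrt_pos.2 ht

lemma Psi_top {α β : ℝ} (hβ : 0 < β) : Tendsto (Psi α β) atTop
    (𝓝 (Real.exp (-(2 * α * β)) * (√Real.pi / 2) - Real.exp (2 * α * β) * (√Real.pi / 2))) := by
  have hs : Tendsto (fun t : ℝ => √t) atTop atTop := Real.tendsto_sqrt_atTop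
  have h1 : Tendsto (fun t : ℝ => β * √t) atTop atTop := hs.const_mul_atTop hβ
  have h2 : Tendsto (fun t : ℝ => α / √t) atTop (𝓝 0) := hs.const_div_atTop α
  have hq := h1.atTop_add h2
  have hp : Tendsto (fun t : ℝ => β * √t - α / √t) atTop atTop := by
    simpa [sub_eq_add_neg] using h1.atTop_add h2.neg
  exact ((Efn_top.comp hp).const_mul _).sub ((Efn_top.comp hq).const_mul _)

lemma Psi_zero {α β : ℝ} (hα : 0 < α) : Tendsto (Psi α β) (𝓝[>] 0)
    (𝓝 (Real.exp (-(2 * α * β)) * (-(√Real.pi / 2)) - Real.exp (2 * α * β) * (√Real.pi / 2))) := by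
  have hs := sqrt_tendsto_zero
  have h1 : Tendsto (fun t : ℝ => β * √t) (𝓝[>] 0) (𝓝 0) := by
    simpa using (hs.mono_right nhdsWithin_le_nhds).const_mul β
  have h2 : Tendsto (fun t : ℝ => α / √t) (𝓝[>] 0) atTop := by
    simpa [div_eq_mul_inv] using (tendsto_inv_nhdsGT_zero.comp hs).const_mul_atTop hα
  have hq := h1.add_atTop h2
  have hp : Tendsto (fun t : ℝ => β * √t - α / √t) (𝓝[>] 0) atBot := by
    have := h1.add_atBot (tendsto_neg_atTop_atBot.comp h2)
    simpa [sub_eq_add_neg] using! this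
  exact ((Efn_bot.comp hp).const_mul _).sub ((Efn_top.comp hq).const_mul _)

/-- integrability and value from a primitive with one-sided limits -/
lemma Ioi_int {f f' : ℝ → ℝ} {l m : ℝ} (hd : ∀ x ∈ Set.Ioi (0:ℝ), HasDerivAt f (f' x) x)
    (h0 : ∀ x ∈ Set.Ioi (0:ℝ), 0 ≤ f' x) (hl : Tendsto f (𝓝[>] 0) (𝓝 l))
    (hm : Tendsto f atTop (𝓝 m)) :
    IntegrableOn f' (Set.Ioi 0) ∧ ∫ t in Set.Ioi 0, f' t = m - l := by
  set g := Function.update f 0 l with hg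
  have hge : ∀ x, x ≠ 0 → g x = f x := fun x hx => by simp [hg, hx]
  have hgc : ContinuousWithinAt g (Set.Ici 0) 0 := by
    rw [hg, continuousWithinAt_update_same]
    simpa using hl
  have hgd : ∀ x ∈ Set.Ioi (0:ℝ), HasDerivAt g (f' x) x := by
    intro x hx
    refine (hd x hx).congr_of_eventuallyEq ?_
    filter_upwards [Ioi_mem_nhds (show (0:ℝ) < x from hx)] with y hy
    exact hge y (ne_of_gt hy)
  have hgm : Tendsto g atTop (𝓝 m) := by
    refine hm.congr' ?_
    filter_upwards [eventually_gt_atTop 0] with y hy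
    exact (hge y (ne_of_gt hy)).symm
  refine ⟨integrableOn_Ioi_deriv_of_nonneg hgc hgd h0 hgm, ?_⟩
  rw [integral_Ioi_of_hasDerivAt_of_nonneg hgc hgd h0 hgm]
  simp [hg]

lemma glasser {α β : ℝ} (hα : 0 < α) (hβ : 0 < β) :
    IntegrableOn (fun t => α / (t * √t) * Real.exp (-(β ^ 2 * t + α ^ 2 / t))) (Set.Ioi 0) ∧
    ∫ t in Set.Ioi 0, α / (t * √t) * Real.exp (-(β ^ 2 * t + α ^ 2 / t))
      = √Real.pi * Real.exp (-(2 * α * β)) := by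
  have := Ioi_int (f := Psi α β) (fun x hx => Psi_deriv hx) (fun x hx => ?_)
    (Psi_zero hα) (Psi_top hβ)
  · refine ⟨this.1, this.2.trans (by ring)⟩
  · have : (0:ℝ) < x := hx
    positivity

lemma a_int {D s : ℝ} (hD : 0 < D) (hs : 0 < s) :
    IntegrableOn (fun a => D / a ^ 2 * Real.exp (-(D / a))) (Set.Ioo 0 s) ∧
    ∫ a in Set.Ioo 0 s, D / a ^ 2 * Real.exp (-(D / a)) = Real.exp (-(D / s)) := by
  have hd : ∀ x ∈ Set.Ioi (0:ℝ), HasDerivAt (fun a => Real.exp (-(D / a)))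
      (D / x ^ 2 * Real.exp (-(D / x))) x := by
    intro x hx
    have hx' : x ≠ 0 := ne_of_gt hx
    have := (((hasDerivAt_inv hx').const_mul D).neg).exp
    convert! this using 1
    field_simp
    rfl
  have h0 : Tendsto (fun a => Real.exp (-(D / a))) (𝓝[>] 0) (𝓝 0) := by
    refine Real.tendsto_exp_neg_atTop_nhds_zero.comp ?_
    exact tendsto_inv_nhdsGT_zero.const_mul_atTop hD
  have hm : Tendsto (fun a => Real.exp (-(D / a))) atTop (𝓝 1) := by
    have : Tendsto (fun a : ℝ => -(D / a)) atTop (𝓝 0) := by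
      simpa using (tendsto_id.const_div_atTop D).neg
    simpa using! (Real.continuous_exp.tendsto 0).comp this
  have hI := (Ioi_int hd (fun x hx => by positivity) h0 hm).1
  have hI2 : IntegrableOn (fun a => D / a ^ 2 * Real.exp (-(D / a))) (Set.Ioo 0 s) :=
    hI.mono_set Set.Ioo_subset_Ioi_self
  refine ⟨hI2, ?_⟩
  rw [← integral_Ioc_eq_integral_Ioo, ← intervalIntegral.integral_of_le hs.le]
  rw [intervalIntegral.integral_eq_sub_of_hasDerivAt_of_tendsto hs
    (fun x hx => hd x hx.1) _ h0 ((hd s hs).continuousAt.tendsto.mono_left nhdsWithin_le_nhds)]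
  · simp
  · rw [intervalIntegrable_iff_integrableOn_Ioo_of_le hs.le]; exact hI2

lemma poisson_odd (k : ℕ) (hk : 0 < k) (r : ℤ) {b : ℝ} (hb : 0 < b) :
    (∑' n : ℤ, if n ≡ r [ZMOD (k : ℤ)] then (n : ℝ) * Real.exp (-b * (n : ℝ) ^ 2) else 0) =
    ∑' j : ℕ+, 2 * Real.pi * √Real.pi / (k ^ 2 * (b * √b)) * (j : ℝ) *
      Real.sin (2 * Real.pi * ((r : ℝ) / k) * j) *
      Real.exp (-((Real.pi * j / k) ^ 2 / b)) := by
  have hk' : (0 : ℝ) < k := by exact_mod_cast hk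
  have hpi := Real.pi_pos
  set x : ℝ := b * k ^ 2 / Real.pi with hxdef
  have hx : 0 < x := by positivity
  have h1 := (HurwitzZeta.hasSum_int_oddKernel ((r : ℝ) / k) hx).mul_left (k : ℝ)
  have h2 := HurwitzZeta.hasSum_nat_sinKernel ((r : ℝ) / k) (one_div_pos.2 hx)
  rw [HurwitzZeta.oddKernel_functional_equation] at h1
  have hinj : Function.Injective (fun l : ℤ => r + k * l) := by
    intro l l' h
    simpa [hk.ne'] using h
  have hl : (∑' n : ℤ, if n ≡ r [ZMOD (k : ℤ)] then
      (n : ℝ) * Real.exp (-b * (n : ℝ) ^ 2) else 0) =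
      k * (1 / x ^ (3 / 2 : ℝ) * HurwitzZeta.sinKernel (((r : ℝ) / k : ℝ)) (1 / x)) := by
    rw [← h1.tsum_eq, ← hinj.tsum_eq]
    · refine tsum_congr fun l => ?_
      have hc : r + k * l ≡ r [ZMOD (k : ℤ)] := by
        simp [Int.ModEq]
      rw [if_pos hc]
      push_cast
      rw [← mul_assoc]
      congr 1
      · field_simp
        ring
      · congr 1
        rw [hxdef]
        field_simp
        ring
    · intro n hn
      by_cases h : n ≡ r [ZMOD (k : ℤ)]
      · obtain ⟨c, hc⟩ := h.symm.dvd
        exact ⟨c, by simp only; linarith⟩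
      · simp [h] at hn
  rw [hl, ← h2.tsum_eq, ← tsum_pnat_eq_tsum_of_eq_zero (by simp), ← tsum_mul_left, ← tsum_mul_left]
  refine tsum_congr fun j => ?_
  have hx32 : x ^ (3 / 2 : ℝ) = b * k ^ 2 / Real.pi * (√b * k / √Real.pi) := by
    rw [show (3 / 2 : ℝ) = 1 + 1 / 2 by norm_num, Real.rpow_add hx, Real.rpow_one,
      ← Real.sqrt_eq_rpow, hxdef, Real.sqrt_div (by positivity), Real.sqrt_mul hb.le,
      Real.sqrt_sq hk'.le]
  have he : -Real.pi * (j : ℝ) ^ 2 * (1 / x) = -((Real.pi * j / k) ^ 2 / b) := by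
    rw [hxdef]; field_simp
  rw [hx32, he]
  have : 0 < √b := Real.sqrt_pos.2 hb
  field_simp

noncomputable def Gf (k : ℕ) (e : ℤ) (p : ℕ+ × ℕ+) (t a : ℝ) : ℝ :=
  (4 * √Real.pi * p.1 / (k * a ^ 2) * Real.sin (2 * Real.pi * ((e * p.1 : ℝ) / k) * p.2)) *
   ((Real.pi * p.2 / (k * a)) / (t * √t) *
     Real.exp (-((p.1 : ℝ) ^ 2 * t + (Real.pi * p.2 / (k * a)) ^ 2 / t)))

lemma gauss_summable {b : ℝ} (hb : 0 < b) :
    Summable (fun n : ℤ => (n : ℝ) * Real.exp (-b * (n : ℝ) ^ 2)) := by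
  have := (HurwitzZeta.hasSum_int_oddKernel 0 (div_pos hb Real.pi_pos)).summable
  refine this.congr fun n => ?_
  have := Real.pi_pos
  simp only [add_zero]
  congr 2
  field_simp

lemma gauss_summable_pnat {b : ℝ} (hb : 0 < b) :
    Summable (fun n : ℕ+ => (n : ℝ) * Real.exp (-b * (n : ℝ) ^ 2)) := by
  have := (gauss_summable hb).comp_injective (i := fun n : ℕ+ => (n : ℤ)) (fun a b h => by
    simpa using h)
  exact this.congr fun n => by simp

lemma Gf_summable (k : ℕ) (hk : 0 < k) (e : ℤ) {t a : ℝ} (ht : 0 < t) (ha : 0 < a) :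
    Summable (fun p => Gf k e p t a) := by
  have hk' : (0 : ℝ) < k := by exact_mod_cast hk
  have hpi := Real.pi_pos
  have h1 := gauss_summable_pnat ht
  have h2 := gauss_summable_pnat (b := (Real.pi / (k * a)) ^ 2 / t) (by positivity)
  have h3 := (h1.mul_of_nonneg h2 (fun n => by positivity) (fun n => by positivity)).mul_left
    (4 * √Real.pi / (k * a ^ 2) * (Real.pi / (k * a) / (t * √t)))
  refine Summable.of_norm_bounded h3 fun p => ?_
  have hs := Real.abs_sin_le_one (2 * Real.pi * ((e * p.1 : ℝ) / k) * p.2)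
  have hst : 0 < √t := Real.sqrt_pos.2 ht
  have hid : ‖Gf k e p t a‖ = |Real.sin (2 * Real.pi * ((e * p.1 : ℝ) / k) * p.2)| *
     (4 * √Real.pi / (k * a ^ 2) * (Real.pi / (k * a) / (t * √t)) *
      (p.1 * Real.exp (-t * (p.1 : ℝ) ^ 2) *
        (p.2 * Real.exp (-((Real.pi / (k * a)) ^ 2 / t) * (p.2 : ℝ) ^ 2)))) := by
    rw [Gf, Real.norm_eq_abs, abs_mul, abs_mul, abs_of_nonneg (a := 4 * √Real.pi * p.1 / (k * a ^ 2))
      (by positivity), abs_of_nonneg (a := _ * Real.exp _) (by positivity)]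
    rw [show -((p.1 : ℝ) ^ 2 * t + (Real.pi * p.2 / (k * a)) ^ 2 / t) =
      -t * (p.1 : ℝ) ^ 2 + -((Real.pi / (k * a)) ^ 2 / t) * (p.2 : ℝ) ^ 2 by ring, Real.exp_add]
    ring
  rw [hid]
  exact mul_le_of_le_one_left (by positivity) hs

open Classical in
lemma pointwise (k : ℕ) (hk : 0 < k) (ε εs : ℤ) 
    (hεs : ε * εs ≡ 1 [ZMOD (k : ℤ)]) {t a : ℝ} (ht : 0 < t) (ha : 0 < a) :
    (∑' mn : ℤ × ℤ,
      if mn.1 ≡ ε * mn.2 [ZMOD (k : ℤ)] then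
        (mn.1 * mn.2 : ℝ) * Real.exp (-t * ((mn.1 : ℝ) ^ 2 + (mn.2 : ℝ) ^ 2 * a ^ 2))
      else 0) = ∑' p, Gf k εs p t a := by
  have hk' : (0 : ℝ) < k := by exact_mod_cast hk
  have hpi := Real.pi_pos
  have hb : 0 < t * a ^ 2 := by positivity
  have hcond : ∀ m n : ℤ, m ≡ ε * n [ZMOD (k : ℤ)] ↔ n ≡ εs * m [ZMOD (k : ℤ)] := by
    intro m n
    constructor
    · intro h
      have h1 := (h.mul_left εs)
      have h2 := hεs.mul_right n
      calc n ≡ ε * εs * n [ZMOD (k : ℤ)] := by simpa using h2.symm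
        _ = εs * (ε * n) := by ring
        _ ≡ εs * m [ZMOD (k : ℤ)] := h1.symm
    · intro h
      have h1 := (h.mul_left ε)
      have h2 := hεs.mul_right m
      calc m ≡ ε * εs * m [ZMOD (k : ℤ)] := by simpa using h2.symm
        _ = ε * (εs * m) := by ring
        _ ≡ ε * n [ZMOD (k : ℤ)] := h1.symm
  have hterm : ∀ m n : ℤ, (if m ≡ ε * n [ZMOD (k : ℤ)] then
        (m * n : ℝ) * Real.exp (-t * ((m : ℝ) ^ 2 + (n : ℝ) ^ 2 * a ^ 2)) else 0) =
      (m * Real.exp (-t * (m : ℝ) ^ 2)) * (if n ≡ εs * m [ZMOD (k : ℤ)] then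
        (n : ℝ) * Real.exp (-(t * a ^ 2) * (n : ℝ) ^ 2) else 0) := by
    intro m n
    simp only [hcond, mul_ite, mul_zero]
    congr 1
    rw [show -t * ((m : ℝ) ^ 2 + (n : ℝ) ^ 2 * a ^ 2) =
      -t * (m : ℝ) ^ 2 + -(t * a ^ 2) * (n : ℝ) ^ 2 by ring, Real.exp_add]
    ring
  have hsum : Summable (fun mn : ℤ × ℤ => (if mn.1 ≡ ε * mn.2 [ZMOD (k : ℤ)] then
        (mn.1 * mn.2 : ℝ) * Real.exp (-t * ((mn.1 : ℝ) ^ 2 + (mn.2 : ℝ) ^ 2 * a ^ 2)) else 0)) := by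
    have h1 := (gauss_summable ht).norm.mul_of_nonneg (gauss_summable hb).norm
      (fun n => norm_nonneg _) (fun n => norm_nonneg _)
    refine Summable.of_norm_bounded h1 fun p => ?_
    rw [hterm, norm_mul]
    gcongr
    split_ifs
    · exact le_rfl
    · rw [norm_zero]; exact norm_nonneg _
  have hG := Gf_summable k hk εs ht ha
  rw [hsum.tsum_prod, hG.tsum_prod]
  simp only [hterm, tsum_mul_left, poisson_odd k hk _ hb]
  have hev : Function.Even (fun m : ℤ => (m * Real.exp (-t * (m : ℝ) ^ 2)) * ∑' j : ℕ+,
      2 * Real.pi * √Real.pi / (k ^ 2 * (t * a ^ 2 * √(t * a ^ 2))) * (j : ℝ) *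
      Real.sin (2 * Real.pi * (((εs * m : ℤ) : ℝ) / k) * j) *
      Real.exp (-((Real.pi * j / k) ^ 2 / (t * a ^ 2)))) := by
    intro m
    simp only [← tsum_mul_left]
    refine tsum_congr fun j => ?_
    push_cast
    rw [show 2 * Real.pi * ((εs * -m : ℝ) / k) * j = -(2 * Real.pi * ((εs * m : ℝ) / k) * j) by ring,
      Real.sin_neg, neg_sq]
    ring
  rw [tsum_int_eq_zero_add_two_mul_tsum_pnat hev]
  · simp only [Int.cast_zero, zero_mul, zero_add]
    rw [two_nsmul, ← two_mul, ← tsum_mul_left]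
    refine tsum_congr fun m => ?_
    rw [← tsum_mul_left, ← tsum_mul_left]
    refine tsum_congr fun j => ?_
    rw [Gf]
    push_cast
    rw [neg_add, Real.exp_add]
    rw [Real.sqrt_mul ht.le, Real.sqrt_sq ha.le]
    have hst : 0 < √t := Real.sqrt_pos.2 ht
    rw [show (Real.pi * j / k) ^ 2 / (t * a ^ 2) = (Real.pi * j / (k * a)) ^ 2 / t by field_simp]
    rw [show -t * (m : ℝ) ^ 2 = -((m : ℝ) ^ 2 * t) by ring]
    field_simp
    ring
  · have := hsum.prod
    simpa only [hterm, tsum_mul_left, poisson_odd k hk _ hb] using this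

lemma integrable_tsum_real {X ι : Type*} [MeasurableSpace X] [Countable ι] {μ : Measure X}
    {f : ι → X → ℝ} (hf : ∀ i, Integrable (f i) μ) (hs : Summable fun i => ∫ x, ‖f i x‖ ∂μ) :
    Integrable (fun x => ∑' i, f i x) μ := by
  refine ⟨(AEMeasurable.tsum fun i => (hf i).aemeasurable).aestronglyMeasurable, ?_⟩
  have h1 : ∫⁻ x, ‖∑' i, f i x‖ₑ ∂μ ≤ ∑' i, ∫⁻ x, ‖f i x‖ₑ ∂μ := by
    rw [← lintegral_tsum (fun i => (hf i).aemeasurable.enorm)]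
    exact lintegral_mono fun x => enorm_tsum_le_tsum_enorm
  refine lt_of_le_of_lt h1 ?_
  have h2 : ∀ i, ∫⁻ x, ‖f i x‖ₑ ∂μ = ENNReal.ofReal (∫ x, ‖f i x‖ ∂μ) := fun i =>
    (ofReal_integral_norm_eq_lintegral_enorm (hf i)).symm
  simp only [h2]
  exact (hs.tsum_ofReal_lt_top)

lemma Gf_int_t (k : ℕ) (hk : 0 < k) (e : ℤ) (p : ℕ+ × ℕ+) {a : ℝ} (ha : 0 < a) :
    IntegrableOn (fun t => Gf k e p t a) (Set.Ioi 0) ∧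
    (∫ t in Set.Ioi 0, Gf k e p t a = 2 / p.2 * Real.sin (2 * Real.pi * ((e * p.1 : ℝ) / k) * p.2) *
      ((2 * Real.pi * p.1 * p.2 / k) / a ^ 2 * Real.exp (-((2 * Real.pi * p.1 * p.2 / k) / a)))) ∧
    (∫ t in Set.Ioi 0, ‖Gf k e p t a‖ =
      2 / p.2 * |Real.sin (2 * Real.pi * ((e * p.1 : ℝ) / k) * p.2)| *
      ((2 * Real.pi * p.1 * p.2 / k) / a ^ 2 *
        Real.exp (-((2 * Real.pi * p.1 * p.2 / k) / a)))) := by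
  have hk' : (0 : ℝ) < k := by exact_mod_cast hk
  have hpi := Real.pi_pos
  have hp2 : (0 : ℝ) < p.2 := by exact_mod_cast p.2.pos
  have hp1 : (0 : ℝ) < p.1 := by exact_mod_cast p.1.pos
  have hα : 0 < Real.pi * p.2 / (k * a) := by positivity
  obtain ⟨g1, g2⟩ := glasser hα hp1
  have hsp : √Real.pi * √Real.pi = Real.pi := Real.mul_self_sqrt hpi.le
  have he : 2 * (Real.pi * p.2 / (k * a)) * (p.1 : ℝ) = (2 * Real.pi * p.1 * p.2 / k) / a := by
    field_simp
  rw [he] at g2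
  have key : ∀ S E : ℝ, 4 * √Real.pi * p.1 / (k * a ^ 2) * S * (√Real.pi * E) =
      2 / p.2 * S * ((2 * Real.pi * p.1 * p.2 / k) / a ^ 2 * E) := by
    intro S E
    have : 4 * √Real.pi * p.1 / (k * a ^ 2) * S * (√Real.pi * E) =
      4 * (√Real.pi * √Real.pi) * p.1 / (k * a ^ 2) * S * E := by ring
    rw [this, hsp]
    field_simp
    ring
  refine ⟨g1.const_mul _, ?_, ?_⟩
  · simp only [Gf]
    rw [integral_const_mul, g2, key]
  · have : ∀ t ∈ Set.Ioi (0 : ℝ), ‖Gf k e p t a‖ =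
       (4 * √Real.pi * p.1 / (k * a ^ 2) *
         |Real.sin (2 * Real.pi * ((e * p.1 : ℝ) / k) * p.2)|) *
       ((Real.pi * p.2 / (k * a)) / (t * √t) *
         Real.exp (-((p.1 : ℝ) ^ 2 * t + (Real.pi * p.2 / (k * a)) ^ 2 / t))) := by
      intro t ht
      have ht : 0 < t := ht
      rw [Gf, Real.norm_eq_abs, abs_mul, abs_mul,
        abs_of_nonneg (a := 4 * √Real.pi * p.1 / (k * a ^ 2)) (by positivity),
        abs_of_nonneg (a := _ * Real.exp _) (by positivity)]
    rw [setIntegral_congr_fun measurableSet_Ioi this, integral_const_mul, g2, key]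

lemma Gf_meas (k : ℕ) (e : ℤ) (p : ℕ+ × ℕ+) :
    Measurable (fun z : ℝ × ℝ => Gf k e p z.1 z.2) := by
  unfold Gf
  fun_prop

lemma Gf_int (k : ℕ) (hk : 0 < k) (e : ℤ) (p : ℕ+ × ℕ+) {s : ℝ} (hs : 0 < s) :
    Integrable (fun z : ℝ × ℝ => Gf k e p z.1 z.2)
      ((volume.restrict (Set.Ioi (0 : ℝ))).prod (volume.restrict (Set.Ioo (0 : ℝ) s))) ∧
    (∫ z, Gf k e p z.1 z.2
      ∂((volume.restrict (Set.Ioi (0 : ℝ))).prod (volume.restrict (Set.Ioo (0 : ℝ) s)))) =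
      2 / p.2 * Real.sin (2 * Real.pi * ((e * p.1 : ℝ) / k) * p.2) *
        Real.exp (-((2 * Real.pi * p.1 * p.2 / k) / s)) ∧
    (∫ z, ‖Gf k e p z.1 z.2‖
      ∂((volume.restrict (Set.Ioi (0 : ℝ))).prod (volume.restrict (Set.Ioo (0 : ℝ) s)))) =
      2 / p.2 * |Real.sin (2 * Real.pi * ((e * p.1 : ℝ) / k) * p.2)| *
        Real.exp (-((2 * Real.pi * p.1 * p.2 / k) / s)) := by
  have hk' : (0 : ℝ) < k := by exact_mod_cast hk
  have hpi := Real.pi_pos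
  have hp2 : (0 : ℝ) < p.2 := by exact_mod_cast p.2.pos
  have hp1 : (0 : ℝ) < p.1 := by exact_mod_cast p.1.pos
  have hD : 0 < 2 * Real.pi * p.1 * p.2 / k := by positivity
  obtain ⟨a1, a2⟩ := a_int hD hs
  have hI : Integrable (fun z : ℝ × ℝ => Gf k e p z.1 z.2)
      ((volume.restrict (Set.Ioi (0 : ℝ))).prod (volume.restrict (Set.Ioo (0 : ℝ) s))) := by
    rw [integrable_prod_iff' (Gf_meas k e p).aestronglyMeasurable]
    constructor
    · filter_upwards [ae_restrict_mem measurableSet_Ioo] with a ha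
      exact (Gf_int_t k hk e p ha.1).1
    · refine (IntegrableOn.congr_fun (a1.const_mul (2 / p.2 *
        |Real.sin (2 * Real.pi * ((e * p.1 : ℝ) / k) * p.2)|)) (fun a ha => ?_) measurableSet_Ioo)
      exact (Gf_int_t k hk e p ha.1).2.2.symm
  refine ⟨hI, ?_, ?_⟩
  · rw [integral_prod_symm _ hI]
    simp only
    rw [setIntegral_congr_fun measurableSet_Ioo (fun a ha => (Gf_int_t k hk e p ha.1).2.1),
      integral_const_mul, a2]
  · rw [integral_prod_symm _ hI.norm]
    simp only
    rw [setIntegral_congr_fun measurableSet_Ioo (fun a ha => (Gf_int_t k hk e p ha.1).2.2),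
      integral_const_mul, a2]

lemma exp_summable {r : ℝ} (hr : 0 < r) :
    Summable (fun p : ℕ+ × ℕ+ => Real.exp (-(r * p.1 * p.2))) := by
  have h1 : Summable (fun n : ℕ+ => Real.exp (-r * n)) := by
    have : Summable (fun n : ℕ => Real.exp (n * (-r))) :=
      Real.summable_exp_nat_mul_iff.2 (by linarith)
    refine (this.comp_injective PNat.coe_injective).congr fun n => ?_
    simp [mul_comm]
  have h2 := (h1.mul_of_nonneg h1 (fun _ => (Real.exp_pos _).le)
    (fun _ => (Real.exp_pos _).le)).mul_left (Real.exp r)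
  refine Summable.of_nonneg_of_le (fun _ => (Real.exp_pos _).le) (fun p => ?_) h2
  rw [← Real.exp_add, ← Real.exp_add]
  apply Real.exp_le_exp.2
  have hp2 : (1 : ℝ) ≤ p.2 := by exact_mod_cast one_le (a := p.2)
  have hp1 : (1 : ℝ) ≤ p.1 := by exact_mod_cast one_le (a := p.1)
  have := mul_nonneg (mul_nonneg hr.le (sub_nonneg.2 hp1)) (sub_nonneg.2 hp2)
  nlinarith

lemma Fke_eq (k : ℕ) (hk : 0 < k) (ε εs : ℤ) (hεs : ε * εs ≡ 1 [ZMOD (k : ℤ)]) (s : ℝ)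
    (hs : 0 < s) :
    Fke k ε s = ∑' p : ℕ+ × ℕ+, 2 / p.2 * Real.sin (2 * Real.pi * ((εs * p.1 : ℝ) / k) * p.2) *
        Real.exp (-((2 * Real.pi * p.1 * p.2 / k) / s)) := by
  have hk' : (0 : ℝ) < k := by exact_mod_cast hk
  have hpi := Real.pi_pos
  have h1 : Fke k ε s = ∫ t in Set.Ioi (0 : ℝ), ∫ a in Set.Ioo (0 : ℝ) s,
      ∑' p, Gf k εs p t a := by
    unfold Fke
    refine setIntegral_congr_fun measurableSet_Ioi fun t ht => ?_
    refine setIntegral_congr_fun measurableSet_Ioo fun a ha => ?_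
    exact pointwise k hk ε εs hεs ht ha.1
  have hsum : Summable fun p => ∫ z, ‖Gf k εs p z.1 z.2‖
      ∂((volume.restrict (Set.Ioi (0 : ℝ))).prod (volume.restrict (Set.Ioo (0 : ℝ) s))) := by
    have hr : 0 < 2 * Real.pi / (k * s) := by positivity
    refine Summable.of_nonneg_of_le (fun p => integral_nonneg fun _ => norm_nonneg _)
      (fun p => ?_) ((exp_summable hr).mul_left 2)
    rw [(Gf_int k hk εs p hs).2.2]
    have hp2 : (1 : ℝ) ≤ p.2 := by exact_mod_cast one_le (a := p.2)
    rw [show -(2 * Real.pi * p.1 * p.2 / k / s) = -(2 * Real.pi / (k * s) * p.1 * p.2) by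
      field_simp]
    gcongr
    calc (2 : ℝ) / p.2 * |Real.sin (2 * Real.pi * ((εs * p.1 : ℝ) / k) * p.2)| ≤ 2 / 1 * 1 := by
          gcongr
          exact Real.abs_sin_le_one _
      _ = 2 := by norm_num
  have hI := integrable_tsum_real (fun p => (Gf_int k hk εs p hs).1) hsum
  rw [h1, ← integral_prod (fun z : ℝ × ℝ => ∑' p, Gf k εs p z.1 z.2) hI,
    ← integral_tsum_of_summable_integral_norm (fun p => (Gf_int k hk εs p hs).1) hsum]
  exact tsum_congr fun p => (Gf_int k hk εs p hs).2.1

lemma Leta_sum (τ : ℂ) (hτ : 0 < τ.im) :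
    Summable (fun p : ℕ+ × ℕ+ => (1 / (p.2 : ℂ)) *
      Complex.exp (2 * Real.pi * Complex.I * (p.1 * p.2) * τ)) ∧
    (∑' n : ℕ, ((∑ d ∈ (n + 1).divisors, d : ℕ) : ℂ) / (n + 1) *
      Complex.exp (2 * Real.pi * Complex.I * (n + 1) * τ)) =
    ∑' p : ℕ+ × ℕ+, (1 / (p.2 : ℂ)) *
      Complex.exp (2 * Real.pi * Complex.I * (p.1 * p.2) * τ) := by
  have hpi := Real.pi_pos
  have hS : Summable (fun p : ℕ+ × ℕ+ => (1 / (p.2 : ℂ)) *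
      Complex.exp (2 * Real.pi * Complex.I * (p.1 * p.2) * τ)) := by
    refine Summable.of_norm_bounded (exp_summable (r := 2 * Real.pi * τ.im) (by positivity))
      fun p => ?_
    rw [norm_mul, Complex.norm_exp]
    have hp2 : (1 : ℝ) ≤ p.2 := by exact_mod_cast one_le (a := p.2)
    have hre : (2 * Real.pi * Complex.I * (p.1 * p.2) * τ).re
        = -(2 * Real.pi * τ.im * p.1 * p.2) := by
      have : (2 * Real.pi * Complex.I * (p.1 * p.2) * τ) =
        ((2 * Real.pi * p.1 * p.2 : ℝ) : ℂ) * (Complex.I * τ) := by push_cast; ring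
      rw [this, Complex.re_ofReal_mul, Complex.I_mul_re]; ring
    rw [hre]
    apply mul_le_of_le_one_left (Real.exp_pos _).le
    simp only [one_div, norm_inv, Complex.norm_natCast]
    exact inv_le_one_of_one_le₀ hp2
  refine ⟨hS, ?_⟩
  have h1 := tsum_pnat_eq_tsum_succ (f := fun n : ℕ => ((∑ d ∈ n.divisors, d : ℕ) : ℂ) / n *
      Complex.exp (2 * Real.pi * Complex.I * n * τ))
  simp only [Nat.cast_add, Nat.cast_one] at h1
  rw [← h1, ← sigmaAntidiagonalEquivProd.tsum_eq, Summable.tsum_sigma]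
  · refine tsum_congr fun n => ?_
    have hn : ((n : ℕ) : ℂ) ≠ 0 := by simp
    rw [tsum_fintype]
    have h2 : ∀ x : Nat.divisorsAntidiagonal n, (1 / ((sigmaAntidiagonalEquivProd ⟨n, x⟩).2 : ℂ)) *
      Complex.exp (2 * Real.pi * Complex.I * ((sigmaAntidiagonalEquivProd ⟨n, x⟩).1 *
        (sigmaAntidiagonalEquivProd ⟨n, x⟩).2) * τ) = 
        (fun y : ℕ × ℕ => (y.1 : ℂ) / n * Complex.exp (2 * Real.pi * Complex.I * n * τ)) x.1 := by
      intro x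
      have hx := (Nat.mem_divisorsAntidiagonal.mp x.2).1
      have e1 : ((sigmaAntidiagonalEquivProd ⟨n, x⟩).1 : ℕ) = x.1.1 := rfl
      have e2 : ((sigmaAntidiagonalEquivProd ⟨n, x⟩).2 : ℕ) = x.1.2 := rfl
      rw [e1, e2]
      have hx' : (x.1.1 : ℂ) * x.1.2 = n := by exact_mod_cast hx
      simp only
      rw [hx']
      have h0 : (x.1.2 : ℂ) ≠ 0 := by
        intro h; rw [h, mul_zero] at hx'; exact hn hx'.symm
      have h0' : (x.1.1 : ℂ) ≠ 0 := by
        intro h; rw [h, zero_mul] at hx'; exact hn hx'.symm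
      rw [← hx']
      field_simp
    rw [Finset.sum_congr rfl (fun x _ => h2 x)]
    rw [Finset.univ_eq_attach, Finset.sum_attach (n : ℕ).divisorsAntidiagonal
      (fun y : ℕ × ℕ => (y.1 : ℂ) / n * Complex.exp (2 * Real.pi * Complex.I * n * τ)),
      Nat.sum_divisorsAntidiagonal (fun x _ => (x : ℂ) / n *
        Complex.exp (2 * Real.pi * Complex.I * n * τ)), ← Finset.sum_mul, ← Finset.sum_div]
    push_cast
    rfl
  · exact (sigmaAntidiagonalEquivProd.summable_iff.2 hS)

/-- Proposition A.1: `F_{k,ε}(s) = 2·Im L((−ε* + i s⁻¹)/k) + πε*/(6k)` whenever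
`ε·ε* ≡ 1 (mod k)`. -/
theorem stmt10 (k : ℕ) (hk : 0 < k) (ε εs : ℤ) (hcop : IsCoprime ε (k : ℤ))
    (hεs : ε * εs ≡ 1 [ZMOD (k : ℤ)]) (s : ℝ) (hs : 0 < s) :
    Fke k ε s =
      2 * (Leta ((-(εs : ℂ) + Complex.I * (s : ℂ)⁻¹) / (k : ℂ))).im +
        Real.pi * εs / (6 * k) := by
  have hk' : (0 : ℝ) < k := by exact_mod_cast hk
  have hτ : ((-(εs : ℂ) + Complex.I * (s : ℂ)⁻¹) / (k : ℂ)) =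
      ((-εs / k : ℝ) : ℂ) + ((1 / (s * k) : ℝ) : ℂ) * Complex.I := by
    push_cast
    have : (k : ℂ) ≠ 0 := by exact_mod_cast hk.ne'
    have : (s : ℂ) ≠ 0 := by exact_mod_cast hs.ne'
    field_simp
  rw [hτ, Fke_eq k hk ε εs hεs s hs]
  set τ : ℂ := ((-εs / k : ℝ) : ℂ) + ((1 / (s * k) : ℝ) : ℂ) * Complex.I with hτd
  have him : τ.im = 1 / (s * k) := by
    rw [hτd, Complex.add_im, Complex.ofReal_im, Complex.im_ofReal_mul]; simp
  have hre : τ.re = -εs / k := by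
    rw [hτd, Complex.add_re, Complex.ofReal_re, Complex.re_ofReal_mul]; simp
  obtain ⟨hS, hE⟩ := Leta_sum τ (by rw [him]; positivity)
  unfold Leta
  rw [hE, Complex.sub_im, Complex.im_tsum hS]
  have h1 : ((Real.pi : ℂ) * Complex.I * τ / 12).im = - (Real.pi * εs / (12 * k)) := by
    have : ((Real.pi : ℂ) * Complex.I * τ / 12) = ((Real.pi / 12 : ℝ) : ℂ) * (Complex.I * τ) := by
      push_cast; ring
    rw [this, Complex.im_ofReal_mul, Complex.I_mul_im, hre]
    field_simp
  have h2 : ∀ p : ℕ+ × ℕ+, ((1 / (p.2 : ℂ)) *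
      Complex.exp (2 * Real.pi * Complex.I * (p.1 * p.2) * τ)).im =
      -(1 / 2) * (2 / p.2 * Real.sin (2 * Real.pi * ((εs * p.1 : ℝ) / k) * p.2) *
        Real.exp (-((2 * Real.pi * p.1 * p.2 / k) / s))) := by
    intro p
    have e1 : (2 * Real.pi * Complex.I * (p.1 * p.2) * τ) =
        ((2 * Real.pi * p.1 * p.2 : ℝ) : ℂ) * (Complex.I * τ) := by push_cast; ring
    rw [show (1 / (p.2 : ℂ)) = ((1 / p.2 : ℝ) : ℂ) by push_cast; rfl, Complex.im_ofReal_mul, e1,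
      Complex.exp_im, Complex.re_ofReal_mul, Complex.im_ofReal_mul, Complex.I_mul_re,
      Complex.I_mul_im, hre, him,
      show 2 * Real.pi * p.1 * p.2 * (-εs / k) =
        -(2 * Real.pi * ((εs * p.1 : ℝ) / k) * p.2) by ring, Real.sin_neg,
      show 2 * Real.pi * p.1 * p.2 * -(1 / (s * k)) =
        -((2 * Real.pi * p.1 * p.2 / k) / s) by field_simp]
    ring
  simp only [h2, h1, tsum_mul_left]
  ring
end

section
/- The theta function Θ_{k,ε}(s, t) = Σ_{m ≡ εn (mod k)} m·n·e^{−πt(m²/s + n²s)/k} (sum over integer pairs) satisfies Θ_{k,ε}(s, t) = −Θ_{k,−ε}(s, t), Θ_{k,ε}(s, t) = Θ_{k,ε*}(s^{−1}, t) where ε·ε* ≡ 1 (mod k), and Θ_{k,ε}(s, t) = t^{−3}·Θ_{k,ε}(s, t^{−1}). -/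
-- `Θ_{k,ε}(s, t) = Σ_{m ≡ εn (mod k)} m·n·e^{−πt(m²/s + n²s)/k}`, the sum running over
-- all pairs `(m, n) ∈ ℤ²` with `m ≡ εn (mod k)` (appendix, Section A.1).
open Classical in
noncomputable def Theta (k : ℕ) (ε : ℤ) (s t : ℝ) : ℝ :=
  ∑' mn : ℤ × ℤ,
    if mn.1 ≡ ε * mn.2 [ZMOD (k : ℤ)] then
      (mn.1 * mn.2 : ℝ) *
        Real.exp (-Real.pi * t * ((mn.1 : ℝ) ^ 2 / s + (mn.2 : ℝ) ^ 2 * s) / k)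
    else 0

open HurwitzZeta in
lemma oddGauss_summable (c : ℝ) (hc : 0 < c) :
    Summable (fun n : ℤ => |(n : ℝ) * Real.exp (-Real.pi * (n : ℝ) ^ 2 * c)|) := by
  have := (hasSum_int_oddKernel 0 hc).summable.abs
  simpa using this

open HurwitzZeta in
lemma S_symm_aux (k : ℕ) (ε : ℤ) (c d : ℝ) (hc : 0 < c) (hd : 0 < d) :
    ∑' n : ℤ, (n : ℝ) * Real.exp (-Real.pi * (n : ℝ) ^ 2 * c) *
        sinKernel ((ε * n / k : ℝ) : UnitAddCircle) d =
      ∑' n : ℤ, (n : ℝ) * Real.exp (-Real.pi * (n : ℝ) ^ 2 * d) *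
        sinKernel ((ε * n / k : ℝ) : UnitAddCircle) c := by
  apply Complex.ofReal_injective
  rw [Complex.ofReal_tsum, Complex.ofReal_tsum]
  have key : ∀ c d : ℝ, 0 < d → ∀ n : ℤ,
      (((n : ℝ) * Real.exp (-Real.pi * (n : ℝ) ^ 2 * c) *
        sinKernel ((ε * n / k : ℝ) : UnitAddCircle) d : ℝ) : ℂ) =
      ∑' m : ℤ, (((n : ℝ) * Real.exp (-Real.pi * (n : ℝ) ^ 2 * c) : ℝ) : ℂ) *
        (-Complex.I * m * Complex.exp (2 * Real.pi * Complex.I * ((ε * n / k : ℝ) : ℂ) * m) *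
          (Real.exp (-Real.pi * (m : ℝ) ^ 2 * d) : ℝ)) := by
    intro c d hd n
    rw [tsum_mul_left, (hasSum_int_sinKernel (ε * n / k : ℝ) hd).tsum_eq]
    push_cast
    rfl
  simp_rw [key c d hd, key d c hc]
  rw [← Summable.tsum_comm]
  · refine tsum_congr fun m => tsum_congr fun n => ?_
    have : 2 * (Real.pi : ℂ) * Complex.I * ((ε * m / k : ℝ) : ℂ) * n =
        2 * Real.pi * Complex.I * ((ε * n / k : ℝ) : ℂ) * m := by push_cast; ring
    rw [this]
    push_cast
    ring
  · apply Summable.of_norm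
    have h := (oddGauss_summable d hd).mul_of_nonneg (oddGauss_summable c hc)
      (fun _ => abs_nonneg _) (fun _ => abs_nonneg _)
    have h2 := (Equiv.prodComm ℤ ℤ).summable_iff.mpr h
    refine h2.congr fun p => ?_
    obtain ⟨n, m⟩ := p
    have : ‖Complex.exp (2 * Real.pi * Complex.I * ((ε * n / k : ℝ) : ℂ) * m)‖ = 1 := by
      have := Complex.norm_exp_ofReal_mul_I (2 * Real.pi * (ε * n / k) * m)
      rw [← this]; congr 2; push_cast; ring
    simp only [Function.uncurry, Function.comp, Equiv.prodComm_apply, Prod.swap, norm_mul, this,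
      Complex.norm_real, Real.norm_eq_abs, abs_mul,
      norm_neg, Complex.norm_I, Complex.norm_intCast]
    ring

open Classical in
lemma Theta_summable (k : ℕ) (hk : 0 < k) (ε : ℤ) (s t : ℝ) (hs : 0 < s) (ht : 0 < t) :
    Summable (fun mn : ℤ × ℤ =>
    if mn.1 ≡ ε * mn.2 [ZMOD (k : ℤ)] then
      (mn.1 * mn.2 : ℝ) *
        Real.exp (-Real.pi * t * ((mn.1 : ℝ) ^ 2 / s + (mn.2 : ℝ) ^ 2 * s) / k)
    else 0) := by
  have hk' : (0 : ℝ) < k := by exact_mod_cast hk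
  have h := (oddGauss_summable (t / s / k) (by positivity)).mul_of_nonneg
    (oddGauss_summable (t * s / k) (by positivity))
    (fun _ => abs_nonneg _) (fun _ => abs_nonneg _)
  refine Summable.of_norm_bounded h fun p => ?_
  have : (p.1 * p.2 : ℝ) *
      Real.exp (-Real.pi * t * ((p.1 : ℝ) ^ 2 / s + (p.2 : ℝ) ^ 2 * s) / k) =
      ((p.1 : ℝ) * Real.exp (-Real.pi * (p.1 : ℝ) ^ 2 * (t / s / k))) *
      ((p.2 : ℝ) * Real.exp (-Real.pi * (p.2 : ℝ) ^ 2 * (t * s / k))) := by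
    rw [mul_mul_mul_comm, ← Real.exp_add]
    congr 2
    field_simp
    ring
  split_ifs
  · rw [this, Real.norm_eq_abs, abs_mul]
  · rw [norm_zero]; positivity

open HurwitzZeta in
lemma Theta_eq_aux (k : ℕ) (hk : 0 < k) (ε : ℤ) (s t : ℝ) (hs : 0 < s) (ht : 0 < t) :
    Theta k ε s t = k * ∑' n : ℤ, (n : ℝ) * Real.exp (-Real.pi * (n : ℝ) ^ 2 * (t * s / k)) *
        oddKernel ((ε * n / k : ℝ) : UnitAddCircle) (k * t / s) := by
  have hk' : (0 : ℝ) < k := by exact_mod_cast hk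
  unfold Theta
  rw [← (Equiv.prodComm ℤ ℤ).tsum_eq, Summable.tsum_prod, ← tsum_mul_left]
  · refine tsum_congr fun n => ?_
    have h0 := ((hasSum_int_oddKernel (ε * n / k : ℝ) (x := k * t / s) (by positivity)).mul_left
      (k * ((n : ℝ) * Real.exp (-Real.pi * (n : ℝ) ^ 2 * (t * s / k))))).tsum_eq
    rw [← mul_assoc, ← h0]
    have hinj : Function.Injective (fun l : ℤ => (k : ℤ) * l + ε * n) := by
      intro a b h
      have : (k : ℤ) ≠ 0 := by exact_mod_cast hk.ne'
      exact mul_left_cancel₀ this (add_right_cancel h)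
    rw [← hinj.tsum_eq]
    · refine tsum_congr fun l => ?_
      have hmod : (k : ℤ) * l + ε * n ≡ ε * n [ZMOD (k : ℤ)] := by
        simp [Int.ModEq]
      refine (if_pos hmod).trans ?_
      change (((k : ℤ) * l + ε * n : ℤ) : ℝ) * (n : ℝ) * Real.exp (-Real.pi * t *
          ((((k : ℤ) * l + ε * n : ℤ) : ℝ) ^ 2 / s + (n : ℝ) ^ 2 * s) / k) = _
      have : Real.exp (-Real.pi * t *
          ((((k : ℤ) * l + ε * n : ℤ) : ℝ) ^ 2 / s + (n : ℝ) ^ 2 * s) / k) =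
          Real.exp (-Real.pi * (n : ℝ) ^ 2 * (t * s / k)) *
          Real.exp (-Real.pi * (l + ε * n / k) ^ 2 * (k * t / s)) := by
        rw [← Real.exp_add]
        congr 1
        push_cast
        field_simp
        ring
      rw [this]
      push_cast
      field_simp
    · intro m hm
      have hmod : m ≡ ε * n [ZMOD (k : ℤ)] := by
        by_contra hcon
        exact hm (if_neg hcon)
      obtain ⟨q, hq⟩ := hmod.symm.dvd
      exact ⟨q, by simp only; linarith⟩
  · have h := (Equiv.prodComm ℤ ℤ).summable_iff.mpr (Theta_summable k hk ε s t hs ht)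
    exact h

open HurwitzZeta in
lemma Theta_eq_sin (k : ℕ) (hk : 0 < k) (ε : ℤ) (s t : ℝ) (hs : 0 < s) (ht : 0 < t) :
    Theta k ε s t = k * (1 / (k * t / s) ^ (3 / 2 : ℝ)) *
      ∑' n : ℤ, (n : ℝ) * Real.exp (-Real.pi * (n : ℝ) ^ 2 * (t * s / k)) *
        sinKernel ((ε * n / k : ℝ) : UnitAddCircle) (t⁻¹ * s / k) := by
  rw [Theta_eq_aux k hk ε s t hs ht, mul_assoc]
  congr 1
  rw [← tsum_mul_left]
  refine tsum_congr fun n => ?_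
  rw [oddKernel_functional_equation]
  have : 1 / (k * t / s) = t⁻¹ * s / k := by field_simp
  rw [this]
  ring

/-- The functional equations (A.4) of the theta series: `Θ_{k,ε}(s,t) = −Θ_{k,−ε}(s,t)`,
`Θ_{k,ε}(s,t) = Θ_{k,ε*}(s⁻¹,t)` where `ε·ε* ≡ 1 (mod k)`, and
`Θ_{k,ε}(s,t) = t⁻³·Θ_{k,ε}(s,t⁻¹)`. -/
theorem stmt11 (k : ℕ) (hk : 0 < k) (ε εs : ℤ)
    (hεs : ε * εs ≡ 1 [ZMOD (k : ℤ)]) (s t : ℝ) (hs : 0 < s) (ht : 0 < t) :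
    Theta k ε s t = -Theta k (-ε) s t ∧
      Theta k ε s t = Theta k εs s⁻¹ t ∧
      Theta k ε s t = t⁻¹ ^ 3 * Theta k ε s t⁻¹ := by
  refine ⟨?_, ?_, ?_⟩
  · unfold Theta
    rw [← tsum_neg, ← ((Equiv.neg ℤ).prodCongr (Equiv.refl ℤ)).tsum_eq]
    refine tsum_congr fun p => ?_
    have : (-p.1 ≡ ε * p.2 [ZMOD (k : ℤ)]) ↔ (p.1 ≡ -ε * p.2 [ZMOD (k : ℤ)]) := by
      constructor <;> intro h <;> simpa using h.neg
    simp only [Equiv.prodCongr_apply, Prod.map, Equiv.neg_apply, Equiv.refl_apply, this]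
    split_ifs
    · push_cast
      rw [neg_sq]
      ring
    · simp
  · unfold Theta
    rw [← (Equiv.prodComm ℤ ℤ).tsum_eq]
    refine tsum_congr fun p => ?_
    have : (p.2 ≡ ε * p.1 [ZMOD (k : ℤ)]) ↔ (p.1 ≡ εs * p.2 [ZMOD (k : ℤ)]) := by
      constructor <;> intro h
      · have h1 := h.mul_left εs
        have h2 := hεs.mul_right p.1
        rw [one_mul, mul_comm ε εs, mul_assoc] at h2
        exact (h1.trans h2).symm
      · have h1 := h.mul_left ε
        have h2 := hεs.mul_right p.2
        rw [one_mul, mul_assoc] at h2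
        exact (h1.trans h2).symm
    simp only [Equiv.prodComm_apply, Prod.swap, this]
    split_ifs
    · rw [mul_comm (p.2 : ℝ)]
      congr 2
      rw [div_inv_eq_mul, ← div_eq_mul_inv]
      ring
    · rfl
  · have hk' : (0 : ℝ) < k := by exact_mod_cast hk
    rw [Theta_eq_sin k hk ε s t hs ht, Theta_eq_sin k hk ε s t⁻¹ hs (by positivity), inv_inv,
      S_symm_aux k ε (t * s / k) (t⁻¹ * s / k) (by positivity) (by positivity), ← mul_assoc]
    congr 1
    have h1 : k * t / s = (k * t⁻¹ / s) * t ^ 2 := by field_simp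
    have h2 : (t ^ 2) ^ (3 / 2 : ℝ) = t ^ 3 := by
      rw [← Real.rpow_natCast, ← Real.rpow_mul ht.le, ← Real.rpow_natCast]
      norm_num
    rw [h1, Real.mul_rpow (by positivity) (by positivity), h2]
    have : (k * t⁻¹ / s) ^ (3 / 2 : ℝ) ≠ 0 := by positivity
    generalize (k * t⁻¹ / s) ^ (3 / 2 : ℝ) = X at *
    field_simp
end
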